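/- arXiv:1001.4698 — 3 statements merged into one kernel-verified Lean document; each statement's English description precedes it below -/
import Mathlib

section
/- Let X be a complex Banach space, A : X → X a bounded linear operator, f : ℝ → X continuous, u₀ ∈ X, α₁, …, α_m real numbers and 0 < t₁ < … < t_m. Suppose the operator B := I + ∑_{k=1}^{m} α_k exp(−t_k A) is invertible, and suppose u : [0,∞) → X satisfies u(t) = exp(−tA) u(0) + ∫₀ᵗ exp(−(t−s)A) f(s) ds for all t ≥ 0 together with the nonlocal condition u(0) + ∑_{k=1}^{m} α_k u(t_k) = u₀. Then for all t ≥ 0, u(t) = exp(−tA) B^{−1} u₀ − exp(−tA) B^{−1} ∑_{i=1}^{m} α_i ∫₀^{t_i} exp(−(t_i−s)A) f(s) ds + ∫₀ᵗ exp(−(t−s)A) f(s) ds. -/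
/-- If `u` satisfies the variation-of-constants formula together with the nonlocal condition
`u(0) + ∑ α_k u(t_k) = u₀`, and `B = I + ∑ α_k exp(-t_k A)` is invertible (inverse `Binv`),
then `u(t) = exp(-tA) B⁻¹ u₀ - exp(-tA) B⁻¹ ∑ α_i ∫₀^{t_i} exp(-(t_i-s)A) f(s) ds
+ ∫₀ᵗ exp(-(t-s)A) f(s) ds` for all `t ≥ 0`. -/
theorem stmt_5 {X : Type*} [NormedAddCommGroup X] [NormedSpace ℂ X] [CompleteSpace X]
    (A : X →L[ℂ] X) (f : ℝ → X) (hf : Continuous f) (u₀ : X)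
    (m : ℕ) (α t : Fin m → ℝ) (ht0 : ∀ k, 0 < t k) (htmono : StrictMono t)
    (B Binv : X →L[ℂ] X)
    (hB : B = 1 + ∑ k, (α k : ℂ) • NormedSpace.exp ((-(t k : ℂ)) • A))
    (hB₁ : B.comp Binv = 1) (hB₂ : Binv.comp B = 1)
    (u : ℝ → X)
    (hu : ∀ s : ℝ, 0 ≤ s → u s = NormedSpace.exp ((-(s : ℂ)) • A) (u 0) +
        ∫ τ in (0 : ℝ)..s, NormedSpace.exp ((-((s - τ : ℝ) : ℂ)) • A) (f τ))
    (hnl : u 0 + ∑ k, α k • u (t k) = u₀) :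
    ∀ s : ℝ, 0 ≤ s →
      u s = NormedSpace.exp ((-(s : ℂ)) • A) (Binv u₀)
        - NormedSpace.exp ((-(s : ℂ)) • A)
            (Binv (∑ k, α k • ∫ τ in (0 : ℝ)..t k,
              NormedSpace.exp ((-((t k - τ : ℝ) : ℂ)) • A) (f τ)))
        + ∫ τ in (0 : ℝ)..s, NormedSpace.exp ((-((s - τ : ℝ) : ℂ)) • A) (f τ) := by
  intro s hs
  have key : B (u 0) = u₀ - ∑ k, α k • ∫ τ in (0 : ℝ)..t k,
      NormedSpace.exp ((-((t k - τ : ℝ) : ℂ)) • A) (f τ) := by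
    have h1 : ∀ k, α k • u (t k) = (α k : ℂ) • NormedSpace.exp ((-(t k : ℂ)) • A) (u 0) +
        α k • ∫ τ in (0 : ℝ)..t k, NormedSpace.exp ((-((t k - τ : ℝ) : ℂ)) • A) (f τ) := by
      intro k
      rw [hu (t k) (ht0 k).le, smul_add, Complex.coe_smul]
    rw [← hnl, Finset.sum_congr rfl (fun k _ => h1 k), Finset.sum_add_distrib, hB,
      ContinuousLinearMap.add_apply, ContinuousLinearMap.sum_apply]
    simp only [ContinuousLinearMap.smul_apply, ContinuousLinearMap.one_apply]
    abel
  have h0 : u 0 = Binv (B (u 0)) := by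
    have h := congrArg (fun T : X →L[ℂ] X => T (u 0)) hB₂
    simpa using h.symm
  rw [key, map_sub] at h0
  rw [hu s hs, ← map_sub, ← h0]
end

section
/- Let X be a complex Banach space, A : X → X a bounded linear operator, f : ℝ → X continuous, u₀ ∈ X, α₁, …, α_m real numbers and 0 < t₁ < … < t_m. Suppose the operator B := I + ∑_{k=1}^{m} α_k exp(−t_k A) is invertible, and define u(t) = exp(−tA) B^{−1} u₀ − exp(−tA) B^{−1} ∑_{i=1}^{m} α_i ∫₀^{t_i} exp(−(t_i−s)A) f(s) ds + ∫₀ᵗ exp(−(t−s)A) f(s) ds. Then u satisfies the nonlocal condition u(0) + ∑_{k=1}^{m} α_k u(t_k) = u₀. -/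
/-- The function `u(t) = exp(-tA) B⁻¹ u₀ - exp(-tA) B⁻¹ ∑ α_i ∫₀^{t_i} exp(-(t_i-s)A) f(s) ds
+ ∫₀ᵗ exp(-(t-s)A) f(s) ds` satisfies the nonlocal condition `u(0) + ∑ α_k u(t_k) = u₀`. -/
theorem stmt_6 {X : Type*} [NormedAddCommGroup X] [NormedSpace ℂ X] [CompleteSpace X]
    (A : X →L[ℂ] X) (f : ℝ → X) (hf : Continuous f) (u₀ : X)
    (m : ℕ) (α t : Fin m → ℝ) (ht0 : ∀ k, 0 < t k) (htmono : StrictMono t)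
    (B Binv : X →L[ℂ] X)
    (hB : B = 1 + ∑ k, (α k : ℂ) • NormedSpace.exp ((-(t k : ℂ)) • A))
    (hB₁ : B.comp Binv = 1) (hB₂ : Binv.comp B = 1)
    (u : ℝ → X)
    (hu : ∀ s : ℝ, u s = NormedSpace.exp ((-(s : ℂ)) • A) (Binv u₀)
        - NormedSpace.exp ((-(s : ℂ)) • A)
            (Binv (∑ k, α k • ∫ τ in (0 : ℝ)..t k,
              NormedSpace.exp ((-((t k - τ : ℝ) : ℂ)) • A) (f τ)))
        + ∫ τ in (0 : ℝ)..s, NormedSpace.exp ((-((s - τ : ℝ) : ℂ)) • A) (f τ)) :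
    u 0 + ∑ k, α k • u (t k) = u₀ := by
  have key : ∀ x : X, x + ∑ k, α k • NormedSpace.exp ((-(t k : ℂ)) • A) x = B x := by
    intro x
    simp [hB, ContinuousLinearMap.sum_apply]
  have hBB : ∀ x, B (Binv x) = x := fun x => by
    have := congrArg (fun L : X →L[ℂ] X => L x) hB₁
    simpa using this
  have h0 : u 0 = Binv u₀ - Binv (∑ k, α k • ∫ τ in (0 : ℝ)..t k,
              NormedSpace.exp ((-((t k - τ : ℝ) : ℂ)) • A) (f τ)) := by
    rw [hu 0]
    simp [NormedSpace.exp_zero]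
  have hk : ∀ k, u (t k) = NormedSpace.exp ((-(t k : ℂ)) • A) (u 0)
      + ∫ τ in (0 : ℝ)..t k, NormedSpace.exp ((-((t k - τ : ℝ) : ℂ)) • A) (f τ) := by
    intro k
    rw [hu (t k), h0, map_sub]
  simp_rw [hk, smul_add]
  rw [Finset.sum_add_distrib, ← add_assoc, key, h0, map_sub, hBB, hBB, sub_add_cancel]
end

section
/- Let X be a complex Banach space, A : X → X a bounded linear operator, c a complex number and r > 0 with ‖A − cI‖ < r < |c|. Then A is invertible, for every z on the circle |z − c| = r the operator zI − A is invertible, and for every natural number m and every v ∈ X, (1/(2πi)) ∮_{|z−c|=r} z^{−(m+1)} (zI − A)^{−1} v dz = (A^{−1})^{m+1} v, where the circle is traversed once counterclockwise. -/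
open scoped Real

lemma isUnit_aux {X : Type*} [NormedAddCommGroup X] [NormedSpace ℂ X] [CompleteSpace X]
    (B : X →L[ℂ] X) (w : ℂ) (h : ‖B‖ < ‖w‖) : IsUnit (w • (1 : X →L[ℂ] X) - B) := by
  have hw : w ≠ 0 := norm_pos_iff.1 ((norm_nonneg B).trans_lt h)
  have h1 : IsUnit (1 - w⁻¹ • B) := by
    apply isUnit_one_sub_of_norm_lt_one
    rw [norm_smul, norm_inv, inv_mul_lt_iff₀ (norm_pos_iff.2 hw)]
    simpa using h
  have h2 : w • (1 : X →L[ℂ] X) - B = (Units.mk0 w hw) • (1 - w⁻¹ • B) := by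
    rw [Units.smul_mk0, smul_sub, smul_smul, mul_inv_cancel₀ hw, one_smul]
  rw [h2]
  exact h1.smul _

lemma circle_aux {X : Type*} [NormedAddCommGroup X] [NormedSpace ℂ X] [CompleteSpace X]
    (A : X →L[ℂ] X) (a c : ℂ) (r : ℝ) (hr : 0 < r) (F : ℂ → X)
    (hF : ContinuousOn F (Metric.sphere c r)) (v : X)
    (hA : ∀ z ∈ Metric.sphere c r, (z - a) • F z = v + A (F z))
    (ha : ∀ z ∈ Metric.sphere c r, z - a ≠ 0) (k : ℕ) :
    (∮ z in C(c, r), ((z - a) ^ k)⁻¹ • F z) =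
      (∮ z in C(c, r), ((z - a) ^ (k + 1))⁻¹) • v +
        A (∮ z in C(c, r), ((z - a) ^ (k + 1))⁻¹ • F z) := by
  have hc : ContinuousOn (fun z : ℂ => ((z - a) ^ (k + 1))⁻¹) (Metric.sphere c r) :=
    ContinuousOn.inv₀ (by fun_prop) (fun z hz => pow_ne_zero _ (ha z hz))
  have hi : CircleIntegrable (fun z => ((z - a) ^ (k + 1))⁻¹ • F z) c r :=
    (hc.smul hF).circleIntegrable hr.le
  have hAi : A (∮ z in C(c, r), ((z - a) ^ (k + 1))⁻¹ • F z) =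
      ∮ z in C(c, r), ((z - a) ^ (k + 1))⁻¹ • A (F z) := by
    unfold circleIntegral
    rw [← ContinuousLinearMap.intervalIntegral_comp_comm _ hi.out]
    simp
  rw [hAi, ← circleIntegral.integral_smul_const, ← circleIntegral.integral_add]
  · apply circleIntegral.integral_congr hr.le
    intro z hz
    have := ha z hz
    simp only
    rw [← smul_add, ← hA z hz, smul_smul]
    congr 1
    field_simp
    ring
  · exact (hc.smul continuousOn_const).circleIntegrable hr.le
  · exact (hc.smul (A.continuous.comp_continuousOn hF)).circleIntegrable hr.le

/-- If `‖A - cI‖ < r < |c|`, then `A` is invertible, `zI - A` is invertible for every `z`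
on the circle `|z - c| = r`, and the Dunford–Cauchy integral
`(1/(2πi)) ∮_{|z-c|=r} z^{-(m+1)} (zI - A)^{-1} v dz` equals `(A⁻¹)^{m+1} v`. -/
theorem stmt_17 {X : Type*} [NormedAddCommGroup X] [NormedSpace ℂ X] [CompleteSpace X]
    (A : X →L[ℂ] X) (c : ℂ) (r : ℝ) (hr : 0 < r)
    (hAc : ‖A - c • (1 : X →L[ℂ] X)‖ < r) (hrc : r < ‖c‖) :
    IsUnit A ∧
    (∀ z : ℂ, ‖z - c‖ = r → IsUnit (z • (1 : X →L[ℂ] X) - A)) ∧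
    ∀ (m : ℕ) (v : X),
      (2 * (π : ℂ) * Complex.I)⁻¹ •
          ∫ θ in (0 : ℝ)..2 * π,
            (Complex.I * r * Complex.exp ((θ : ℂ) * Complex.I) *
                ((c + r * Complex.exp ((θ : ℂ) * Complex.I)) ^ (m + 1))⁻¹) •
              Ring.inverse
                ((c + r * Complex.exp ((θ : ℂ) * Complex.I)) • (1 : X →L[ℂ] X) - A) v
        = (Ring.inverse A ^ (m + 1)) v := by
  have hU : ∀ z : ℂ, ‖z - c‖ = r → IsUnit (z • (1 : X →L[ℂ] X) - A) := by
    intro z hz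
    have := isUnit_aux (A - c • (1 : X →L[ℂ] X)) (z - c) (by rw [hz]; exact hAc)
    convert this using 1
    rw [sub_smul]; abel
  have hUA : IsUnit A := by
    have := isUnit_aux (-(A - c • (1 : X →L[ℂ] X))) c (by rw [norm_neg]; linarith)
    convert this using 1
    abel
  refine ⟨hUA, hU, fun m v => ?_⟩
  set F : ℂ → X := fun z => Ring.inverse (z • (1 : X →L[ℂ] X) - A) v with hFdef
  have hFc : ContinuousOn F (Metric.sphere c r) := by
    intro z hz
    obtain ⟨u, hu⟩ := hU z (by simpa [dist_eq_norm] using hz)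
    have h1 : ContinuousAt (Ring.inverse : (X →L[ℂ] X) → _) (z • (1 : X →L[ℂ] X) - A) := by
      rw [← hu]; exact NormedRing.inverse_continuousAt u
    have h2 : ContinuousAt (fun z : ℂ => z • (1 : X →L[ℂ] X) - A) z := by fun_prop
    have h3 : ContinuousAt (fun z : ℂ => Ring.inverse (z • (1 : X →L[ℂ] X) - A)) z :=
      ContinuousAt.comp (f := fun z : ℂ => z • (1 : X →L[ℂ] X) - A) h1 h2
    exact (h3.clm_apply continuousAt_const).continuousWithinAt
  have hF : ∀ z ∈ Metric.sphere c r, z • F z = v + A (F z) := by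
    intro z hz
    have h := Ring.mul_inverse_cancel _ (hU z (by simpa [dist_eq_norm] using hz))
    have h := congrArg (fun T : X →L[ℂ] X => T v) h
    simp only [ContinuousLinearMap.mul_apply, ContinuousLinearMap.sub_apply,
      ContinuousLinearMap.smul_apply, ContinuousLinearMap.one_apply] at h
    exact sub_eq_iff_eq_add.1 h
  have hF' : ∀ z ∈ Metric.sphere c r,
      (z - c) • F z = v + (A - c • (1 : X →L[ℂ] X)) (F z) := by
    intro z hz
    simp only [sub_smul, hF z hz, ContinuousLinearMap.sub_apply,
      ContinuousLinearMap.smul_apply, ContinuousLinearMap.one_apply]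
    abel
  have hc0 : ∀ z ∈ Metric.sphere c r, z - c ≠ 0 := by
    intro z hz h
    rw [mem_sphere_iff_norm, h, norm_zero] at hz
    linarith
  have h00 : ∀ z ∈ Metric.closedBall c r, z ≠ 0 := by
    rintro z hz rfl
    rw [mem_closedBall_iff_norm, zero_sub, norm_neg] at hz
    linarith
  -- the plain resolvent integral
  set B := A - c • (1 : X →L[ℂ] X) with hB
  have hJ : ∀ k : ℕ, (∮ z in C(c, r), F z) = (2 * (π : ℂ) * Complex.I) • v +
      (B ^ (k + 1)) (∮ z in C(c, r), ((z - c) ^ (k + 1))⁻¹ • F z) := by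
    intro k
    induction k with
    | zero =>
      have := circle_aux B c c r hr F hFc v hF' hc0 0
      simpa [circleIntegral.integral_sub_center_inv c hr.ne'] using this
    | succ k ih =>
      rw [ih, circle_aux B c c r hr F hFc v hF' hc0 (k + 1)]
      have hz : (∮ z in C(c, r), ((z - c) ^ (k + 1 + 1))⁻¹) = 0 := by
        have := circleIntegral.integral_sub_zpow_of_ne (n := -((k + 2 : ℕ) : ℤ))
          (by push_cast; omega) c c r
        simpa only [zpow_neg, zpow_natCast] using this
      rw [hz, zero_smul, zero_add, pow_succ B (k + 1)]
      rfl
  obtain ⟨C, hC⟩ := (isCompact_sphere c r).exists_bound_of_continuousOn hFc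
  have hI0 : (∮ z in C(c, r), F z) = (2 * (π : ℂ) * Complex.I) • v := by
    rw [← sub_eq_zero, ← norm_le_zero_iff]
    have hlim : Filter.Tendsto (fun k : ℕ => (‖B‖ / r) ^ (k + 1) * (2 * π * r * C))
        Filter.atTop (nhds 0) := by
      have := ((tendsto_pow_atTop_nhds_zero_of_lt_one (r := ‖B‖ / r) (by positivity)
        ((div_lt_one hr).2 hAc)).comp (Filter.tendsto_add_atTop_nat 1)).mul_const (2 * π * r * C)
      simpa using this
    refine ge_of_tendsto' hlim fun k => ?_
    rw [hJ k, add_sub_cancel_left]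
    have hb : ‖∮ z in C(c, r), ((z - c) ^ (k + 1))⁻¹ • F z‖ ≤
        2 * π * r * ((r ^ (k + 1))⁻¹ * C) := by
      apply circleIntegral.norm_integral_le_of_norm_le_const hr.le
      intro z hz
      have hz' := mem_sphere_iff_norm.1 hz
      rw [norm_smul, norm_inv, norm_pow, hz']
      exact mul_le_mul_of_nonneg_left (hC z hz) (by positivity)
    calc _ ≤ ‖B ^ (k + 1)‖ * ‖∮ z in C(c, r), ((z - c) ^ (k + 1))⁻¹ • F z‖ :=
          ContinuousLinearMap.le_opNorm _ _
      _ ≤ ‖B‖ ^ (k + 1) * (2 * π * r * ((r ^ (k + 1))⁻¹ * C)) :=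
          mul_le_mul (norm_pow_le' B (Nat.succ_pos k)) hb (norm_nonneg _) (by positivity)
      _ = _ := by rw [div_pow]; ring
  have hinv : ∀ x : X, Ring.inverse A (A x) = x := fun x =>
    congrArg (fun T : X →L[ℂ] X => T x) (Ring.inverse_mul_cancel A hUA)
  have hI : ∀ k : ℕ, (∮ z in C(c, r), (z ^ k)⁻¹ • F z) =
      (2 * (π : ℂ) * Complex.I) • (Ring.inverse A ^ k) v := by
    intro k
    induction k with
    | zero => simpa using hI0
    | succ k ih =>
      have h := circle_aux A 0 c r hr F hFc v (by simpa using hF)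
        (fun z hz => by simpa using h00 z (Metric.sphere_subset_closedBall hz)) k
      have hz : (∮ z in C(c, r), (z ^ (k + 1))⁻¹) = 0 := by
        apply Complex.circleIntegral_eq_zero_of_differentiable_on_off_countable hr.le
          Set.countable_empty
        · exact ContinuousOn.inv₀ (by fun_prop) (fun z hz => pow_ne_zero _ (h00 z hz))
        · intro z hz
          exact DifferentiableAt.inv (by fun_prop)
            (pow_ne_zero _ (h00 z (Metric.ball_subset_closedBall hz.1)))
      simp only [sub_zero] at h
      rw [hz, zero_smul, zero_add, ih] at h
      rw [← hinv (∮ z in C(c, r), (z ^ (k + 1))⁻¹ • F z), ← h, map_smul, pow_succ']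
      rfl
  have hne : (2 * (π : ℂ) * Complex.I) ≠ 0 := Complex.two_pi_I_ne_zero
  rw [inv_smul_eq_iff₀ hne, ← hI (m + 1)]
  unfold circleIntegral
  apply intervalIntegral.integral_congr
  intro θ _
  simp only [deriv_circleMap, circleMap, hFdef, smul_smul, zero_add]
  congr 1
  ring
end
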